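/- Let n ≥ 1 and let π be any n-cycle in S_n. Then the IO-polynomial F_π(z) is log-concave; that is, its coefficient sequence a_0, a_1, …, a_d satisfies a_k² ≥ a_{k−1}·a_{k+1} for all 1 ≤ k ≤ d−1. -/

import Mathlib

open Finset Polynomial

/-- Number of cycles of a permutation, counting fixed points as cycles of length 1
(equivalently, the number of orbits). -/
noncomputable def cycleCount {α : Type*} [Fintype α] [DecidableEq α] (σ : Equiv.Perm α) : ℕ :=
  σ.cycleType.card + (Finset.univ.filter fun x => σ x = x).card

/-- The IO-polynomial `F_π(z) = Σ_{ζ ∈ Q_n} z^⌊(c(ζπ)-1)/2⌋`, where `Q_n` is the set of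
`n`-cycles of `S_n` (i.e. permutations with a single cycle), and `ζπ` applies `ζ` first
and then `π`. -/
noncomputable def IOPoly {n : ℕ} (π : Equiv.Perm (Fin n)) : Polynomial ℝ :=
  ∑ ζ ∈ Finset.univ.filter (fun ζ : Equiv.Perm (Fin n) => cycleCount ζ = 1),
    Polynomial.X ^ ((cycleCount (π * ζ) - 1) / 2)

open Equiv Equiv.Perm

section CycleCount

variable {α β : Type*} [Fintype α] [DecidableEq α] [Fintype β] [DecidableEq β]

/-- The set of cycles of a permutation, fixed points included. -/
abbrev CycleQuotient {α : Type*} (σ : Perm α) : Type _ := Quotient (SameCycle.setoid σ)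

theorem CycleQuotient.mk_eq_iff {α : Type*} {σ : Perm α} {x y : α} :
    (Quotient.mk (SameCycle.setoid σ) x = Quotient.mk (SameCycle.setoid σ) y) ↔
      SameCycle σ x y :=
  Quotient.eq (r := SameCycle.setoid σ)

theorem cycleCount_eq_card_cycleQuotient (σ : Perm α) :
    cycleCount σ = Nat.card (CycleQuotient σ) := by
  have hne : ∀ c : {c // c ∈ σ.cycleFactorsFinset}, ∃ x, x ∈ c.1.support := fun c =>
    ((mem_cycleFactorsFinset_iff.1 c.2).1).nonempty_support
  choose r hr using hne
  let F : {x // σ x = x} ⊕ {c // c ∈ σ.cycleFactorsFinset} → CycleQuotient σ :=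
    Sum.elim (fun x => Quotient.mk _ x.1) (fun c => Quotient.mk _ (r c))
  have hrσ : ∀ c, σ (r c) ≠ r c := fun c =>
    mem_support.1 (mem_cycleFactorsFinset_support_le c.2 (hr c))
  have hF : Function.Bijective F := by
    constructor
    · rintro (⟨x, hx⟩ | c) (⟨y, hy⟩ | d) h
      · have h' := CycleQuotient.mk_eq_iff.1 h
        simpa using h'.eq_of_left hx
      · have h' := CycleQuotient.mk_eq_iff.1 h
        exact absurd (h'.apply_eq_self_iff.1 hx) (hrσ d)
      · have h' := CycleQuotient.mk_eq_iff.1 h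
        exact absurd (h'.apply_eq_self_iff.2 hy) (hrσ c)
      · have h' := CycleQuotient.mk_eq_iff.1 h
        have h1 := cycle_is_cycleOf (hr c) c.2
        have h2 := cycle_is_cycleOf (hr d) d.2
        congr 1
        exact Subtype.ext (by rw [h1, h2, h'.cycleOf_eq])
    · intro q
      obtain ⟨x, rfl⟩ := Quotient.exists_rep q
      by_cases hx : σ x = x
      · exact ⟨Sum.inl ⟨x, hx⟩, rfl⟩
      · have hc : σ.cycleOf x ∈ σ.cycleFactorsFinset :=
          cycleOf_mem_cycleFactorsFinset_iff.2 (mem_support.2 hx)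
        refine ⟨Sum.inr ⟨_, hc⟩, CycleQuotient.mk_eq_iff.2 ?_⟩
        exact ((mem_support_cycleOf_iff.1 (hr ⟨_, hc⟩)).1).symm
  rw [← Nat.card_congr (Equiv.ofBijective F hF), Nat.card_sum, add_comm, cycleCount,
    cycleType_def, Multiset.card_map]
  congr 1
  · simp
  · rw [Nat.card_eq_fintype_card, Fintype.card_subtype]

theorem cycleCount_congr_of_sameCycle {σ : Perm α} {τ : Perm β} (e : α ≃ β)
    (h : ∀ x y, SameCycle σ x y ↔ SameCycle τ (e x) (e y)) : cycleCount σ = cycleCount τ := by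
  rw [cycleCount_eq_card_cycleQuotient, cycleCount_eq_card_cycleQuotient]
  exact Nat.card_congr (Quotient.congr e h)

theorem cycleCount_conj (σ τ : Perm α) : cycleCount (τ * σ * τ⁻¹) = cycleCount σ :=
  (cycleCount_congr_of_sameCycle τ fun x y => by simp [sameCycle_conj]).symm

theorem cycleCount_mul_comm (σ τ : Perm α) : cycleCount (σ * τ) = cycleCount (τ * σ) := by
  rw [← cycleCount_conj (σ * τ) τ]
  congr 1
  group

theorem cycleCount_pos [Nonempty α] (σ : Perm α) : 0 < cycleCount σ := by
  rw [cycleCount_eq_card_cycleQuotient]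
  have : Nonempty (CycleQuotient σ) := ⟨Quotient.mk _ (Classical.arbitrary α)⟩
  exact Nat.card_pos

theorem cycleType_sum_add_card_fixed (σ : Perm α) :
    σ.cycleType.sum + (Finset.univ.filter fun x => σ x = x).card = Fintype.card α := by
  rw [sum_cycleType, ← Finset.card_univ, ← Finset.card_filter_add_card_filter_not (s := univ)
    (fun x => σ x = x), add_comm]
  rfl

theorem sign_eq_neg_one_pow_cycleCount (σ : Perm α) :
    sign σ = (-1 : ℤˣ) ^ (Fintype.card α + cycleCount σ) := by
  rw [sign_of_cycleType, ← cycleType_sum_add_card_fixed σ, cycleCount,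
    show ∀ a b c : ℕ, a + c + (b + c) = a + b + 2 * c by intros; ring, pow_add _ _ (2 * _),
    pow_mul]
  simp

theorem card_add_cycleCount_mod_two {σ : Perm α} (h : sign σ = 1) :
    cycleCount σ % 2 = Fintype.card α % 2 := by
  rw [sign_eq_neg_one_pow_cycleCount] at h
  rcases Nat.even_or_odd (Fintype.card α + cycleCount σ) with h' | h'
  · obtain ⟨k, hk⟩ := h'
    omega
  · rw [h'.neg_one_pow] at h
    exact absurd h (by decide)

/-- Multiplying by a transposition of elements in distinct cycles merges these cycles. -/
theorem cycleCount_mul_swap_add_one {σ : Perm α} {a b : α} (hab : ¬ SameCycle σ a b) :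
    cycleCount (σ * swap a b) + 1 = cycleCount σ := by
  classical
  set τ := σ * swap a b with hτ
  have hne : a ≠ b := fun h => hab (h ▸ SameCycle.rfl)
  have τa : τ a = σ b := by simp [hτ]
  have τb : τ b = σ a := by simp [hτ]
  have τo : ∀ x, x ≠ a → x ≠ b → τ x = σ x := fun x h1 h2 => by
    simp [hτ, swap_apply_of_ne_of_ne h1 h2]
  have walk : ∀ k : ℕ, SameCycle τ b ((σ ^ (k + 1)) a) := by
    intro k
    induction k with
    | zero => simpa [τb] using (sameCycle_apply_right.2 (SameCycle.refl τ b))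
    | succ k ih =>
      have hs : (σ ^ (k + 1 + 1)) a = σ ((σ ^ (k + 1)) a) := by rw [pow_succ']; rfl
      rw [hs]
      by_cases ha : (σ ^ (k + 1)) a = a
      · rw [ha, ← τb]
        exact sameCycle_apply_right.2 SameCycle.rfl
      · have hb : (σ ^ (k + 1)) a ≠ b := fun h => hab ⟨(k + 1 : ℕ), by rw [zpow_natCast]; exact h⟩
        rw [← τo _ ha hb]
        exact sameCycle_apply_right.2 ih
  have hba : SameCycle τ b a := by
    have h1 := walk (orderOf σ - 1)
    rwa [Nat.sub_add_cancel (orderOf_pos σ), pow_orderOf_eq_one] at h1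
  have step : ∀ x, SameCycle τ x (σ x) := by
    intro x
    by_cases h1 : x = a
    · rw [h1, ← τb]; exact sameCycle_apply_right.2 hba.symm
    · by_cases h2 : x = b
      · rw [h2, ← τa]; exact sameCycle_apply_right.2 hba
      · rw [← τo x h1 h2]; exact sameCycle_apply_right.2 SameCycle.rfl
  have hle : ∀ x y, SameCycle σ x y → SameCycle τ x y := by
    intro x y h
    obtain ⟨k, rfl⟩ := h.exists_nat_pow_eq
    induction k with
    | zero => exact SameCycle.rfl
    | succ k ih =>
      rw [pow_succ']
      exact (ih ⟨k, by simp⟩).trans (step _)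
  let qa : CycleQuotient σ := Quotient.mk _ a
  let qb : CycleQuotient σ := Quotient.mk _ b
  have hq : qa ≠ qb := fun h => hab (CycleQuotient.mk_eq_iff.1 h)
  let g : α → {q : CycleQuotient σ // q ≠ qb} := fun x =>
    if h : (Quotient.mk _ x : CycleQuotient σ) = qb then ⟨qa, hq⟩ else ⟨Quotient.mk _ x, h⟩
  have mkσ : ∀ x, (Quotient.mk _ (σ x) : CycleQuotient σ) = Quotient.mk _ x := fun x =>
    CycleQuotient.mk_eq_iff.2 (sameCycle_apply_left.2 SameCycle.rfl)
  have g_congr : ∀ x y, (Quotient.mk _ x : CycleQuotient σ) = Quotient.mk _ y → g x = g y := by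
    intro x y h
    simp only [g, h]
  have gab : g a = g b := by
    have h1 : (Quotient.mk _ a : CycleQuotient σ) ≠ qb := hq
    simp [g, h1, qb, qa]
  have gτ : ∀ x, g (τ x) = g x := by
    intro x
    by_cases h1 : x = a
    · rw [h1, τa, gab]; exact g_congr _ _ (mkσ b)
    · by_cases h2 : x = b
      · rw [h2, τb, ← gab]; exact g_congr _ _ (mkσ a)
      · rw [τo x h1 h2]; exact g_congr _ _ (mkσ x)
  have g_same : ∀ x y, SameCycle τ x y → g x = g y := by
    intro x y h
    obtain ⟨k, rfl⟩ := h.exists_nat_pow_eq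
    clear h
    induction k with
    | zero => rfl
    | succ k ih =>
      rw [pow_succ']
      exact ih.trans (gτ _).symm
  have g_inj : ∀ x y, g x = g y → SameCycle τ x y := by
    have key : ∀ x, ∃ z, (g x).1 = Quotient.mk _ z ∧ SameCycle τ x z := by
      intro x
      by_cases h : (Quotient.mk _ x : CycleQuotient σ) = qb
      · exact ⟨a, by simp [g, h, qa], (hle _ _ (CycleQuotient.mk_eq_iff.1 h)).trans hba⟩
      · exact ⟨x, by simp [g, h], SameCycle.rfl⟩
    intro x y h
    obtain ⟨z, hz, hxz⟩ := key x
    obtain ⟨w, hw, hyw⟩ := key y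
    have : SameCycle σ z w := CycleQuotient.mk_eq_iff.1 (by rw [← hz, ← hw, h])
    exact hxz.trans ((hle _ _ this).trans hyw.symm)
  let G : CycleQuotient τ → {q : CycleQuotient σ // q ≠ qb} := Quotient.lift g g_same
  have hG : Function.Bijective G := by
    constructor
    · rintro ⟨x⟩ ⟨y⟩ h
      exact CycleQuotient.mk_eq_iff.2 (g_inj x y h)
    · rintro ⟨q, hq'⟩
      obtain ⟨x, rfl⟩ := Quotient.exists_rep q
      exact ⟨Quotient.mk _ x, by simp only [G, Quotient.lift_mk, g, dif_neg hq']⟩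
  rw [cycleCount_eq_card_cycleQuotient, cycleCount_eq_card_cycleQuotient,
    Nat.card_congr (Equiv.ofBijective G hG), Nat.card_eq_fintype_card, Nat.card_eq_fintype_card,
    Fintype.card_subtype_compl, Fintype.card_subtype_eq]
  exact Nat.sub_add_cancel (Fintype.card_pos_iff.2 ⟨qb⟩)

theorem cycleCount_permCongr (e : α ≃ β) (σ : Perm α) :
    cycleCount (e.permCongr σ) = cycleCount σ := by
  have hz : ∀ k : ℤ, (e.permCongr σ) ^ k = e.permCongr (σ ^ k) := fun k =>
    (map_zpow e.permCongrHom σ k).symm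
  exact (cycleCount_congr_of_sameCycle e fun x y => by
    simp [SameCycle, hz, Equiv.permCongr_apply]).symm

theorem cycleCount_sumCongr (σ : Perm α) (τ : Perm β) :
    cycleCount (Perm.sumCongr σ τ) = cycleCount σ + cycleCount τ := by
  have hz : ∀ k : ℤ, (Perm.sumCongr σ τ) ^ k = Perm.sumCongr (σ ^ k) (τ ^ k) := fun k =>
    (map_zpow (Perm.sumCongrHom α β) (σ, τ) k).symm
  have hll : ∀ x y, SameCycle (Perm.sumCongr σ τ) (Sum.inl x) (Sum.inl y) ↔ SameCycle σ x y :=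
    fun x y => by simp [SameCycle, hz]
  have hrr : ∀ x y, SameCycle (Perm.sumCongr σ τ) (Sum.inr x) (Sum.inr y) ↔ SameCycle τ x y :=
    fun x y => by simp [SameCycle, hz]
  have hlr : ∀ x y, ¬ SameCycle (Perm.sumCongr σ τ) (Sum.inl x) (Sum.inr y) :=
    fun x y => by simp [SameCycle, hz]
  let F : CycleQuotient σ ⊕ CycleQuotient τ → CycleQuotient (Perm.sumCongr σ τ) :=
    Sum.elim
      (Quotient.lift (fun x => Quotient.mk _ (Sum.inl x))
        fun x y h => CycleQuotient.mk_eq_iff.2 ((hll x y).2 h))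
      (Quotient.lift (fun x => Quotient.mk _ (Sum.inr x))
        fun x y h => CycleQuotient.mk_eq_iff.2 ((hrr x y).2 h))
  have hF : Function.Bijective F := by
    constructor
    · rintro (q | q) (r | r) h <;> obtain ⟨x, rfl⟩ := Quotient.exists_rep q <;>
        obtain ⟨y, rfl⟩ := Quotient.exists_rep r
      · exact congrArg Sum.inl
          (CycleQuotient.mk_eq_iff.2 ((hll x y).1 (CycleQuotient.mk_eq_iff.1 h)))
      · exact absurd (CycleQuotient.mk_eq_iff.1 h) (hlr x y)
      · exact absurd (CycleQuotient.mk_eq_iff.1 h).symm (hlr y x)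
      · exact congrArg Sum.inr
          (CycleQuotient.mk_eq_iff.2 ((hrr x y).1 (CycleQuotient.mk_eq_iff.1 h)))
    · rintro ⟨x | x⟩
      · exact ⟨Sum.inl (Quotient.mk _ x), rfl⟩
      · exact ⟨Sum.inr (Quotient.mk _ x), rfl⟩
  rw [cycleCount_eq_card_cycleQuotient, cycleCount_eq_card_cycleQuotient,
    cycleCount_eq_card_cycleQuotient, ← Nat.card_sum, Nat.card_congr (Equiv.ofBijective F hF)]

theorem cycleCount_subtypeCongr (p : α → Prop) [DecidablePred p] [Fintype {x // p x}]
    [Fintype {x // ¬ p x}] (σ : Perm {x // p x}) (τ : Perm {x // ¬ p x}) :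
    cycleCount (Perm.subtypeCongr σ τ) = cycleCount σ + cycleCount τ := by
  rw [Perm.subtypeCongr, cycleCount_permCongr, cycleCount_sumCongr]

theorem cycleCount_one : cycleCount (1 : Perm α) = Fintype.card α := by
  simp [cycleCount]

theorem cycleCount_optionCongr (σ : Perm α) :
    cycleCount (Equiv.optionCongr σ) = cycleCount σ + 1 := by
  have h : Equiv.optionCongr σ =
      (Equiv.optionEquivSumPUnit.{0} α).symm.permCongr (Perm.sumCongr σ 1) := by
    ext1 x
    cases x <;> simp [Equiv.permCongr_apply]
  rw [h, cycleCount_permCongr, cycleCount_sumCongr, cycleCount_one]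
  simp

theorem cycleCount_swap_none_mul_optionCongr (σ : Perm α) (a : α) :
    cycleCount (swap none (some a) * Equiv.optionCongr σ) = cycleCount σ := by
  have h : ¬ SameCycle (Equiv.optionCongr σ) none (some a) := fun h => by
    have := h.eq_of_left (by simp [Function.IsFixedPt])
    exact absurd this (by simp)
  have := cycleCount_mul_swap_add_one h
  rw [cycleCount_optionCongr] at this
  rw [cycleCount_mul_comm]
  omega

variable {R : Type*} [CommRing R]

theorem sum_pow_cycleCount_option (x : R) :
    ∑ σ : Perm (Option α), x ^ cycleCount σ =
      (x + Fintype.card α) * ∑ σ : Perm α, x ^ cycleCount σ := by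
  rw [← Equiv.sum_comp Perm.decomposeOption.symm (fun σ : Perm (Option α) => x ^ cycleCount σ),
    Fintype.sum_prod_type, Fintype.sum_option]
  simp only [Perm.decomposeOption_symm_apply, cycleCount_swap_none_mul_optionCongr, swap_self,
    Finset.sum_const, Finset.card_univ, nsmul_eq_mul]
  rw [add_mul]
  congr 1
  rw [Finset.mul_sum]
  refine Finset.sum_congr rfl fun σ _ => ?_
  rw [show (Equiv.refl (Option α) : Perm (Option α)) * Equiv.optionCongr σ
    = Equiv.optionCongr σ from one_mul _, cycleCount_optionCongr, pow_succ']

theorem sum_pow_cycleCount_congr (e : α ≃ β) (x : R) :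
    ∑ σ : Perm α, x ^ cycleCount σ = ∑ σ : Perm β, x ^ cycleCount σ :=
  Fintype.sum_equiv e.permCongr _ _ fun σ => by rw [cycleCount_permCongr]

/-- The rising factorial `x (x + 1) ⋯ (x + n - 1)`. -/
def risingFactorial (x : R) (n : ℕ) : R := ∏ i ∈ Finset.range n, (x + i)

/-- The falling factorial `x (x - 1) ⋯ (x - n + 1)`. -/
def fallingFactorial (x : R) (n : ℕ) : R := ∏ i ∈ Finset.range n, (x - i)

theorem risingFactorial_succ (x : R) (n : ℕ) :
    risingFactorial x (n + 1) = risingFactorial x n * (x + n) := Finset.prod_range_succ _ _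

theorem fallingFactorial_succ (x : R) (n : ℕ) :
    fallingFactorial x (n + 1) = fallingFactorial x n * (x - n) := Finset.prod_range_succ _ _

theorem fallingFactorial_eq_neg (x : R) (n : ℕ) :
    fallingFactorial x n = (-1) ^ n * risingFactorial (-x) n := by
  induction n with
  | zero => simp [fallingFactorial, risingFactorial]
  | succ n ih => rw [fallingFactorial_succ, risingFactorial_succ, ih]; ring

variable (α) in
theorem sum_pow_cycleCount (x : R) :
    ∑ σ : Perm α, x ^ cycleCount σ = risingFactorial x (Fintype.card α) := by
  rw [sum_pow_cycleCount_congr (Fintype.equivFin α)]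
  induction Fintype.card α with
  | zero => simp [risingFactorial, cycleCount]
  | succ n ih =>
    rw [sum_pow_cycleCount_congr (finSuccEquiv n), sum_pow_cycleCount_option, ih,
      risingFactorial_succ, Fintype.card_fin, mul_comm]

variable (α) in
theorem sum_sign_mul_pow_cycleCount (x : R) :
    ∑ σ : Perm α, ((sign σ : ℤ) : R) * x ^ cycleCount σ =
      fallingFactorial x (Fintype.card α) := by
  rw [fallingFactorial_eq_neg, ← sum_pow_cycleCount, Finset.mul_sum]
  refine Finset.sum_congr rfl fun σ _ => ?_
  rw [sign_eq_neg_one_pow_cycleCount, neg_pow x]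
  push_cast
  ring

end CycleCount

section InvariantSubsets

variable {α : Type*} [Fintype α] [DecidableEq α]

open Classical in
/-- The number of cycles of `ζ` which meet `S`. -/
noncomputable def cycleCountIn (ζ : Perm α) (S : Finset α) : ℕ :=
  (S.image (Quotient.mk (SameCycle.setoid ζ))).card

/-- The sets `S` which are unions of cycles of `ζ` and avoid `p`, counted with the sign given by
the number of cycles, detect whether `ζ` has only one cycle. -/
theorem sum_invariant_subsets (ζ : Perm α) (p : α) :
    ∑ S ∈ (Finset.univ.erase p).powerset with (∀ x, ζ x ∈ S ↔ x ∈ S),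
      (-1 : ℤ) ^ cycleCountIn ζ S = if cycleCount ζ = 1 then 1 else 0 := by
  classical
  have hsame : ∀ S : Finset α, (∀ x, ζ x ∈ S ↔ x ∈ S) → ∀ x y, SameCycle ζ x y → x ∈ S →
      y ∈ S := by
    intro S hS x y h hx
    obtain ⟨k, rfl⟩ := h.exists_nat_pow_eq
    clear h
    induction k with
    | zero => exact hx
    | succ k ih => rw [pow_succ']; exact (hS _).2 ih
  let m : α → CycleQuotient ζ := Quotient.mk _
  have hm : ∀ x, m (ζ x) = m x := fun x =>
    CycleQuotient.mk_eq_iff.2 (sameCycle_apply_left.2 SameCycle.rfl)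
  have hsum : ∑ S ∈ (Finset.univ.erase p).powerset with (∀ x, ζ x ∈ S ↔ x ∈ S),
      (-1 : ℤ) ^ cycleCountIn ζ S =
      ∑ T ∈ (Finset.univ.erase (m p)).powerset, (-1 : ℤ) ^ T.card := by
    refine Finset.sum_bij' (fun S _ => S.image m)
      (fun T _ => Finset.univ.filter fun x => m x ∈ T) ?_ ?_ ?_ ?_ ?_
    · intro S hS
      simp only [Finset.mem_filter, Finset.mem_powerset, Finset.subset_erase] at hS
      simp only [Finset.mem_powerset, Finset.subset_erase, Finset.mem_image, not_exists, not_and]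
      refine ⟨Finset.subset_univ _, fun x hx hxp => hS.1.2 ?_⟩
      exact hsame S hS.2 x p (CycleQuotient.mk_eq_iff.1 hxp) hx
    · intro T hT
      simp only [Finset.mem_powerset, Finset.subset_erase] at hT
      simp only [Finset.mem_filter, Finset.mem_powerset, Finset.subset_erase, Finset.mem_univ,
        true_and, hm, implies_true, and_true]
      exact ⟨Finset.subset_univ _, hT.2⟩
    · intro S hS
      simp only [Finset.mem_filter, Finset.mem_powerset, Finset.subset_erase] at hS
      ext x
      simp only [Finset.mem_filter, Finset.mem_univ, true_and, Finset.mem_image]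
      exact ⟨fun ⟨y, hy, hyx⟩ => hsame S hS.2 y x (CycleQuotient.mk_eq_iff.1 hyx) hy,
        fun hx => ⟨x, hx, rfl⟩⟩
    · intro T _
      ext q
      obtain ⟨x, rfl⟩ := Quotient.exists_rep q
      simp only [Finset.mem_filter, Finset.mem_univ, true_and, Finset.mem_image]
      exact ⟨fun ⟨y, hy, hyx⟩ => hyx ▸ hy, fun hx => ⟨x, hx, rfl⟩⟩
    · intro S _
      simp only [cycleCountIn, m]
  rw [hsum, Finset.sum_powerset_neg_one_pow_card, cycleCount_eq_card_cycleQuotient,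
    Nat.card_eq_fintype_card, ← Finset.card_univ, ← Finset.card_erase_add_one (Finset.mem_univ (m p))]
  simp [← Finset.card_eq_zero]

omit [Fintype α] in
theorem cycleCountIn_subtypeCongr (S : Finset α) (σ : Perm {x // x ∈ S})
    (τ : Perm {x // ¬ x ∈ S}) :
    cycleCountIn (Perm.subtypeCongr σ τ) S = cycleCount σ := by
  classical
  have hz : ∀ k : ℤ, (Perm.subtypeCongr σ τ) ^ k = Perm.subtypeCongr (σ ^ k) (τ ^ k) := fun k =>
    (map_zpow (Perm.subtypeCongrHom fun x => x ∈ S) (σ, τ) k).symm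
  have hs : ∀ x y : {x // x ∈ S}, SameCycle (Perm.subtypeCongr σ τ) x y ↔ SameCycle σ x y := by
    intro x y
    simp only [SameCycle, hz, Perm.subtypeCongr.left_apply_subtype, Subtype.coe_inj]
  let F : CycleQuotient σ →
      {q // q ∈ S.image (Quotient.mk (SameCycle.setoid (Perm.subtypeCongr σ τ)))} :=
    Quotient.lift (fun x => ⟨Quotient.mk _ x.1, Finset.mem_image_of_mem _ x.2⟩)
      fun x y h => Subtype.ext (CycleQuotient.mk_eq_iff.2 ((hs x y).2 h))
  have hF : Function.Bijective F := by
    constructor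
    · rintro ⟨x⟩ ⟨y⟩ h
      exact CycleQuotient.mk_eq_iff.2 ((hs x y).1 (CycleQuotient.mk_eq_iff.1
        (congrArg Subtype.val h)))
    · rintro ⟨q, hq⟩
      obtain ⟨x, hx, rfl⟩ := Finset.mem_image.1 hq
      exact ⟨Quotient.mk _ ⟨x, hx⟩, rfl⟩
  rw [cycleCount_eq_card_cycleQuotient, Nat.card_congr (Equiv.ofBijective F hF)]
  simp only [cycleCountIn, Nat.card_eq_fintype_card, Fintype.card_coe]

variable {R : Type*} [CommRing R]

/-- The signed sum of `x ^ c(ζπ)` over the permutations `ζ` which preserve `S`. -/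
noncomputable def signedSum (π : Perm α) (x : R) (S : Finset α) : R :=
  ∑ ζ : Perm α with (∀ y, ζ y ∈ S ↔ y ∈ S),
    (-1) ^ cycleCountIn ζ S * x ^ cycleCount (ζ * π)

theorem sum_single_cycles_eq_sum_signedSum (π : Perm α) (p : α) (x : R) :
    ∑ ζ : Perm α with cycleCount ζ = 1, x ^ cycleCount (ζ * π) =
      ∑ S ∈ (Finset.univ.erase p).powerset, signedSum π x S := by
  simp only [signedSum, Finset.sum_filter]
  rw [Finset.sum_comm]
  refine Finset.sum_congr rfl fun ζ _ => ?_
  have h := congrArg (Int.cast : ℤ → R) (sum_invariant_subsets ζ p)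
  rw [← Finset.sum_filter, ← Finset.sum_mul]
  push_cast at h
  rw [h]
  split_ifs <;> simp

omit [Fintype α] in
theorem subtypeCongr_subtypePerm (S : Finset α) (ζ : Perm α) (h : ∀ y, ζ y ∈ S ↔ y ∈ S) :
    Perm.subtypeCongr (ζ.subtypePerm h) (ζ.subtypePerm (p := fun y => ¬ y ∈ S)
      fun y => not_congr (h y)) = ζ := by
  ext y
  by_cases hy : y ∈ S
  · simp [Perm.subtypeCongr.left_apply _ _ hy]
  · simp [Perm.subtypeCongr.right_apply (p := (· ∈ S)) _ _ hy]

theorem signedSum_eq_sum_prod (π : Perm α) (x : R) (S : Finset α) :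
    signedSum π x S = ∑ σ : Perm {x // x ∈ S} × Perm {x // ¬ x ∈ S},
      (-1) ^ cycleCount σ.1 * x ^ cycleCount (Perm.subtypeCongr σ.1 σ.2 * π) := by
  symm
  refine Finset.sum_bij (fun σ _ => Perm.subtypeCongr σ.1 σ.2) ?_ ?_ ?_ ?_
  · rintro ⟨σ, τ⟩ -
    simp only [Finset.mem_filter, Finset.mem_univ, true_and]
    intro y
    by_cases hy : y ∈ S
    · simp [Perm.subtypeCongr.left_apply _ _ hy, hy]
    · have := (τ ⟨y, hy⟩).2
      simpa [Perm.subtypeCongr.right_apply (p := (· ∈ S)) _ _ hy, hy] using this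
  · intro σ _ τ _ h
    exact Perm.subtypeCongrHom_injective _ h
  · intro ζ hζ
    simp only [Finset.mem_filter, Finset.mem_univ, true_and] at hζ
    exact ⟨(_, _), Finset.mem_univ _, subtypeCongr_subtypePerm S ζ hζ⟩
  · rintro ⟨σ, τ⟩ -
    rw [cycleCountIn_subtypeCongr]

theorem signedSum_empty (π : Perm α) (x : R) :
    signedSum π x ∅ = risingFactorial x (Fintype.card α) := by
  rw [← sum_pow_cycleCount, ← Equiv.sum_comp (Equiv.mulRight π) (fun ζ => x ^ cycleCount ζ)]
  simp [signedSum, cycleCountIn]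

theorem neg_one_pow_cycleCount (σ : Perm α) :
    ((-1) ^ cycleCount σ : R) = (-1) ^ Fintype.card α * ((sign σ : ℤ) : R) := by
  rw [sign_eq_neg_one_pow_cycleCount]
  push_cast
  rw [pow_add, ← mul_assoc, ← mul_pow]
  simp

omit [Fintype α] in
theorem subtypeCongr_mul (S : Finset α) (σ σ' : Perm {x // x ∈ S}) (τ τ' : Perm {x // ¬ x ∈ S}) :
    Perm.subtypeCongr (σ * σ') (τ * τ') = Perm.subtypeCongr σ τ * Perm.subtypeCongr σ' τ' :=
  map_mul (Perm.subtypeCongrHom fun x => x ∈ S) (σ, τ) (σ', τ')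

omit [Fintype α] in
theorem subtypeCongr_swap_one (S : Finset α) (a b : {x // x ∈ S}) :
    Perm.subtypeCongr (swap a b) (1 : Perm {x // ¬ x ∈ S}) = swap (a : α) b := by
  ext y
  by_cases hy : y ∈ S
  · rw [Perm.subtypeCongr.left_apply _ _ hy]
    simp only [swap_apply_def, Subtype.ext_iff]
    split_ifs <;> rfl
  · rw [Perm.subtypeCongr.right_apply (p := (· ∈ S)) _ _ hy, swap_apply_of_ne_of_ne]
    · rfl
    · rintro rfl; exact hy a.2
    · rintro rfl; exact hy b.2

omit [Fintype α] in
theorem subtypeCongr_one_swap (S : Finset α) (a b : {x // ¬ x ∈ S}) :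
    Perm.subtypeCongr (1 : Perm {x // x ∈ S}) (swap a b) = swap (a : α) b := by
  ext y
  by_cases hy : y ∈ S
  · rw [Perm.subtypeCongr.left_apply _ _ hy, swap_apply_of_ne_of_ne]
    · rfl
    · rintro rfl; exact a.2 hy
    · rintro rfl; exact b.2 hy
  · rw [Perm.subtypeCongr.right_apply (p := (· ∈ S)) _ _ hy]
    simp only [swap_apply_def, Subtype.ext_iff]
    split_ifs <;> rfl

/-- If `π` maps two elements of `S` out of `S`, the signed sum cancels. -/
theorem signedSum_eq_zero (π : Perm α) (x : R) {S : Finset α} {a b : α} (hab : a ≠ b)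
    (ha : a ∈ S) (hb : b ∈ S) (hπa : π a ∉ S) (hπb : π b ∉ S) : signedSum π x S = 0 := by
  rw [signedSum_eq_sum_prod]
  let s : Perm {x // x ∈ S} := swap ⟨a, ha⟩ ⟨b, hb⟩
  let t : Perm {x // ¬ x ∈ S} := swap ⟨π a, hπa⟩ ⟨π b, hπb⟩
  have hs : sign s = -1 := sign_swap (by simpa using hab)
  refine Finset.sum_involution (fun σ _ => (s * σ.1, σ.2 * t)) ?_ ?_ ?_ ?_
  · rintro ⟨σ, τ⟩ -
    have hc : cycleCount (Perm.subtypeCongr (s * σ) (τ * t) * π) =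
        cycleCount (Perm.subtypeCongr σ τ * π) := by
      have : Perm.subtypeCongr (s * σ) (τ * t) * π =
          swap a b * (Perm.subtypeCongr σ τ * π) * (swap a b)⁻¹ := by
        rw [← one_mul (τ * t), subtypeCongr_mul, ← mul_one σ, subtypeCongr_mul, mul_one,
          subtypeCongr_swap_one, subtypeCongr_one_swap, swap_inv, mul_assoc, mul_assoc,
          ← mul_swap_eq_swap_mul]
        simp only [mul_assoc]
      rw [this, cycleCount_conj]
    rw [hc, neg_one_pow_cycleCount, neg_one_pow_cycleCount, Perm.sign_mul, hs]
    push_cast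
    ring
  · rintro ⟨σ, τ⟩ - - h
    have h1 : s * σ = σ := congrArg Prod.fst h
    have h2 : s = 1 := by simpa using h1
    rw [h2, Perm.sign_one] at hs
    exact absurd hs (by decide)
  · intro σ _
    exact Finset.mem_univ _
  · rintro ⟨σ, τ⟩ -
    simp [s, t, ← mul_assoc, mul_assoc τ]

/-- If `π` is a single cycle and maps exactly one element of `S` out of `S`, the signed sum
factors. -/
theorem mul_signedSum_of_unique (π : Perm α) (hπ : cycleCount π = 1) (x : R) {S : Finset α} {a : α}
    (ha : a ∈ S) (hπa : π a ∉ S) (hS : ∀ y ∈ S, y ≠ a → π y ∈ S) :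
    x * signedSum π x S =
      -(fallingFactorial x S.card * risingFactorial x (Fintype.card α - S.card)) := by
  obtain ⟨b, hb, hπb⟩ : ∃ b, b ∉ S ∧ π b ∈ S := by
    by_contra! h
    refine hπa ?_
    have h1 : ∀ y ∈ S, π⁻¹ y ∈ S := fun y hy => by
      by_contra h2
      exact h _ h2 (by simpa using hy)
    exact perm_symm_on_of_perm_on_finset h1 ha
  set τ := π * swap a b with hτ
  have hτS : ∀ y ∈ S, τ y ∈ S := by
    intro y hy
    by_cases hya : y = a
    · simpa [hτ, hya] using hπb
    · have : y ≠ b := fun h => hb (h ▸ hy)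
      simpa [hτ, swap_apply_of_ne_of_ne hya this] using hS y hy hya
  have hτ' : ∀ y, τ y ∈ S ↔ y ∈ S := fun y =>
    ⟨fun h => by simpa using perm_symm_on_of_perm_on_finset hτS h, hτS y⟩
  have hnot : ∀ ζ₁ : Perm {x // x ∈ S}, ∀ ζ₂ : Perm {x // ¬ x ∈ S},
      ¬ SameCycle (Perm.subtypeCongr ζ₁ ζ₂) a b := by
    rintro ζ₁ ζ₂ ⟨k, hk⟩
    have hz : (Perm.subtypeCongr ζ₁ ζ₂) ^ k = Perm.subtypeCongr (ζ₁ ^ k) (ζ₂ ^ k) :=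
      (map_zpow (Perm.subtypeCongrHom fun x => x ∈ S) (ζ₁, ζ₂) k).symm
    rw [hz, Perm.subtypeCongr.left_apply _ _ ha] at hk
    exact hb (hk ▸ Subtype.property _)
  let τ₁ : Perm {x // x ∈ S} := τ.subtypePerm hτ'
  let τ₂ : Perm {x // ¬ x ∈ S} := τ.subtypePerm fun y => not_congr (hτ' y)
  have hττ : Perm.subtypeCongr τ₁ τ₂ = τ := subtypeCongr_subtypePerm S τ hτ'
  have hπτ : π = τ * swap a b := by simp [hτ, mul_assoc]
  have hτ₁ : cycleCount τ₁ = 1 := by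
    have h1 := cycleCount_mul_swap_add_one (hnot τ₁ τ₂)
    rw [hττ, ← hπτ, hπ, ← hττ, cycleCount_subtypeCongr] at h1
    have : Nonempty {x // x ∈ S} := ⟨⟨a, ha⟩⟩
    have : Nonempty {x // ¬ x ∈ S} := ⟨⟨b, hb⟩⟩
    have := cycleCount_pos τ₁
    have := cycleCount_pos τ₂
    omega
  have hsgn : ∀ β : Perm {x // x ∈ S},
      ((-1) ^ cycleCount (β * τ₁⁻¹) : R) = -((sign β : ℤ) : R) := by
    intro β
    rw [neg_one_pow_cycleCount, Perm.sign_mul, Perm.sign_inv, sign_eq_neg_one_pow_cycleCount τ₁, hτ₁]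
    push_cast
    rw [mul_left_comm, ← mul_assoc, pow_succ, mul_assoc, ← mul_assoc ((-1) ^ _), ← mul_pow]
    simp
  have hcard : Fintype.card {x // ¬ x ∈ S} = Fintype.card α - S.card := by
    rw [Fintype.card_subtype_compl, Fintype.card_coe]
  have hx : ∀ ζ₁ ζ₂, x ^ cycleCount (Perm.subtypeCongr (ζ₁ * τ₁⁻¹) (ζ₂ * τ₂⁻¹) * π) * x =
      x ^ cycleCount ζ₁ * x ^ cycleCount ζ₂ := by
    intro ζ₁ ζ₂
    rw [hπτ, ← mul_assoc, ← hττ, ← subtypeCongr_mul, inv_mul_cancel_right, inv_mul_cancel_right,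
      ← pow_succ, cycleCount_mul_swap_add_one (hnot _ _), cycleCount_subtypeCongr, pow_add]
  rw [signedSum_eq_sum_prod, ← Equiv.sum_comp (Equiv.mulRight
    ((τ₁⁻¹, τ₂⁻¹) : Perm {x // x ∈ S} × Perm {x // ¬ x ∈ S})), ← hcard,
    ← sum_pow_cycleCount, ← Fintype.card_coe S, ← sum_sign_mul_pow_cycleCount,
    Finset.sum_mul_sum, ← Finset.sum_neg_distrib, Finset.mul_sum, Fintype.sum_prod_type]
  refine Finset.sum_congr rfl fun ζ₁ _ => ?_
  rw [← Finset.sum_neg_distrib]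
  refine Finset.sum_congr rfl fun ζ₂ _ => ?_
  simp only [Equiv.coe_mulRight, Prod.mk_mul_mk]
  rw [hsgn, mul_comm, mul_assoc, hx]
  ring

end InvariantSubsets

section Stirling

/-- The rows of the triangle of unsigned Stirling numbers of the first kind are log-concave. -/
theorem stirlingFirst_mul_le (N : ℕ) : ∀ {i j : ℕ} (d : ℕ), i ≤ j →
    Nat.stirlingFirst N i * Nat.stirlingFirst N (j + d) ≤
      Nat.stirlingFirst N (i + d) * Nat.stirlingFirst N j := by
  induction N with
  | zero =>
    intro i j d hij
    rcases Nat.eq_zero_or_pos (j + d) with h | h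
    · obtain rfl : j = 0 := by omega
      obtain rfl : d = 0 := by omega
      obtain rfl : i = 0 := by omega
      rfl
    · obtain ⟨l, hl⟩ := Nat.exists_eq_add_of_le' h
      rw [hl, Nat.stirlingFirst_zero_succ]
      simp
  | succ N ih =>
    intro i j d hij
    rcases d with _ | d
    · rfl
    rcases i with _ | i
    · simp
    obtain ⟨j, rfl⟩ : ∃ l, j = l + 1 := ⟨j - 1, by omega⟩
    have hij : i ≤ j := by omega
    rw [Nat.add_right_comm j 1 (d + 1), Nat.add_right_comm i 1 (d + 1)]
    simp only [Nat.stirlingFirst_succ_succ]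
    have h1 := ih (d + 1) hij
    have h2 := ih (d + 2) hij
    have h3 := ih (d + 1) (Nat.succ_le_succ hij)
    have h4 : Nat.stirlingFirst N (i + 1) * Nat.stirlingFirst N (j + (d + 1)) ≤
        Nat.stirlingFirst N (i + (d + 1)) * Nat.stirlingFirst N (j + 1) := by
      have := ih d (Nat.succ_le_succ hij)
      simpa only [Nat.succ_eq_add_one, add_assoc, add_comm 1] using this
    have h2 := Nat.mul_le_mul_left N h2
    have h3 := Nat.mul_le_mul_left (N * N) h3
    have h4 := Nat.mul_le_mul_left N h4
    rw [Nat.succ_eq_add_one, Nat.succ_eq_add_one, Nat.add_right_comm j 1 (d + 1),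
      Nat.add_right_comm i 1 (d + 1)] at h3
    rw [show j + (d + 2) = j + (d + 1) + 1 from rfl,
      show i + (d + 2) = i + (d + 1) + 1 from rfl] at h2
    linarith

variable {R : Type*} [CommRing R]

theorem coeff_risingFactorial_X (N k : ℕ) :
    (risingFactorial (X : R[X]) N).coeff k = Nat.stirlingFirst N k := by
  induction N generalizing k with
  | zero =>
    rcases k with _ | k <;> simp [risingFactorial, coeff_one]
  | succ N ih =>
    rw [risingFactorial_succ, mul_add]
    rcases k with _ | k
    · rcases N with _ | N <;> simp [ih, mul_coeff_zero]
    · rw [coeff_add, coeff_mul_X, ih, coeff_mul_natCast, ih, Nat.stirlingFirst_succ_succ]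
      push_cast
      ring

theorem coeff_fallingFactorial_X (N k : ℕ) :
    (fallingFactorial (X : R[X]) N).coeff k = (-1) ^ (N + k) * Nat.stirlingFirst N k := by
  induction N generalizing k with
  | zero =>
    rcases k with _ | k <;> simp [fallingFactorial, coeff_one]
  | succ N ih =>
    rw [fallingFactorial_succ, mul_sub]
    rcases k with _ | k
    · rcases N with _ | N <;> simp [ih, mul_coeff_zero]
    · rw [coeff_sub, coeff_mul_X, ih, coeff_mul_natCast, ih, Nat.stirlingFirst_succ_succ]
      push_cast
      ring

theorem sum_fallingFactorial_mul_risingFactorial (x : R) (n : ℕ) :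
    (n : R) * (n + 1) * ∑ k ∈ Finset.range n,
      ((n : R) - k) * (fallingFactorial x k * risingFactorial x (n - k)) =
    n * (n + 1) * risingFactorial x (n + 1) - x * risingFactorial x (n + 1) +
      x * fallingFactorial x (n + 1) := by
  let V : ℕ → R := fun k => fallingFactorial x k * risingFactorial x (n + 1 - k)
  let W : ℕ → R := fun k => (n * ((n : R) + 1 - k) - x) * V k
  have h : ∀ k ∈ Finset.range n, (n : R) * (n + 1) *
      (((n : R) - k) * (fallingFactorial x k * risingFactorial x (n - k))) =
      W k - W (k + 1) := by
    intro k hk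
    obtain ⟨l, rfl⟩ : ∃ l, n = k + l + 1 := ⟨n - k - 1, by simp at hk; omega⟩
    have e1 : k + l + 1 - k = l + 1 := by omega
    have e2 : k + l + 1 + 1 - k = l + 1 + 1 := by omega
    have e3 : k + l + 1 + 1 - (k + 1) = l + 1 := by omega
    simp only [W, V, e1, e2, e3, risingFactorial_succ, fallingFactorial_succ]
    push_cast
    ring
  rw [Finset.mul_sum, Finset.sum_congr rfl h, Finset.sum_range_sub']
  simp only [W, V, fallingFactorial_succ, Nat.sub_zero, Nat.add_sub_cancel_left]
  simp only [fallingFactorial, risingFactorial, Finset.range_zero, Finset.prod_empty,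
    Finset.range_one, Finset.prod_singleton]
  push_cast
  ring

end Stirling

section Rotation

theorem val_finRotate (m : ℕ) (y : Fin (m + 1)) :
    (finRotate (m + 1) y : ℕ) = if (y : ℕ) = m then 0 else (y : ℕ) + 1 := by
  split_ifs with h
  · have : y = Fin.last m := Fin.ext h
    rw [this, finRotate_last]
    rfl
  · exact coe_finRotate_of_ne_last fun h' => h (congrArg Fin.val h')

variable {R : Type*} [CommRing R]

theorem sum_range_sum_range (g : ℕ → R) (m : ℕ) :
    ∑ j ∈ Finset.range (m + 1), ∑ k ∈ Finset.range j, g k =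
      ∑ k ∈ Finset.range m, ((m : R) - k) * g k := by
  induction m with
  | zero => simp
  | succ m ih =>
    rw [Finset.sum_range_succ, ih, Finset.sum_range_succ, Finset.sum_range_succ, ← add_assoc,
      ← Finset.sum_add_distrib]
    push_cast
    congr 1
    · exact Finset.sum_congr rfl fun k _ => by ring
    · ring

theorem sum_pairs (g : ℕ → R) (m : ℕ) :
    ∑ q : Fin (m + 1) × Fin (m + 1) with 0 < q.1 ∧ q.1 ≤ q.2, g (q.2 + 1 - q.1) =
      ∑ k ∈ Finset.range m, ((m : R) - k) * g (k + 1) := by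
  rw [← sum_range_sum_range (fun k => g (k + 1)), ← Fin.sum_univ_eq_sum_range
    (fun j => ∑ k ∈ Finset.range j, g (k + 1)), Finset.sum_filter, Fintype.sum_prod_type_right]
  refine Finset.sum_congr rfl fun j _ => ?_
  rw [← Finset.sum_filter]
  refine Finset.sum_bij (fun i _ => (j : ℕ) - i) ?_ ?_ ?_ ?_
  · intro i hi
    simp only [Finset.mem_filter, Finset.mem_univ, true_and, Fin.lt_def, Fin.le_def,
      Fin.val_zero] at hi
    simp only [Finset.mem_range]
    omega
  · intro i hi i' hi' h
    simp only [Finset.mem_filter, Finset.mem_univ, true_and, Fin.lt_def, Fin.le_def,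
      Fin.val_zero] at hi hi'
    ext
    omega
  · intro k hk
    simp only [Finset.mem_range] at hk
    refine ⟨⟨j - k, by omega⟩, ?_, ?_⟩
    · simp only [Finset.mem_filter, Finset.mem_univ, true_and, Fin.lt_def, Fin.le_def,
        Fin.val_zero]
      omega
    · simp only
      omega
  · intro i hi
    simp only [Finset.mem_filter, Finset.mem_univ, true_and, Fin.lt_def, Fin.le_def,
      Fin.val_zero] at hi
    dsimp only
    congr 1
    omega

/-- A nonempty set avoiding `0` of which only one element is rotated out is an interval. -/
theorem exists_eq_Icc {m : ℕ} {S : Finset (Fin (m + 1))} (h0 : 0 ∉ S) (hS : S.Nonempty)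
    (h : ∀ a ∈ S, ∀ b ∈ S, finRotate (m + 1) a ∉ S → finRotate (m + 1) b ∉ S → a = b) :
    ∃ i j : Fin (m + 1), 0 < i ∧ i ≤ j ∧ S = Finset.Icc i j := by
  have hi := S.min'_mem hS
  have hj := S.max'_mem hS
  have hij := S.min'_le _ hj
  have hle : ∀ y ∈ S, y ≤ S.max' hS := fun y hy => S.le_max' y hy
  have hge : ∀ y ∈ S, S.min' hS ≤ y := fun y hy => S.min'_le y hy
  generalize S.min' hS = i at *
  generalize S.max' hS = j at *
  have hjr : finRotate (m + 1) j ∉ S := by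
    intro hr
    have h1 := Fin.le_def.1 (hle _ hr)
    rw [val_finRotate] at h1
    split_ifs at h1 with h2
    · refine h0 ?_
      convert hr using 1
      ext
      rw [val_finRotate, if_pos h2]
      rfl
    · omega
  have hmem : ∀ d : ℕ, ∀ y : Fin (m + 1), (y : ℕ) = i + d → y ≤ j → y ∈ S := by
    intro d
    induction d with
    | zero =>
      intro y hy _
      rwa [show y = i from Fin.ext hy]
    | succ d ih =>
      intro y hy hyj
      have hyj := Fin.le_def.1 hyj
      let z : Fin (m + 1) := ⟨i + d, by omega⟩
      have hz : z ∈ S := ih z rfl (Fin.le_def.2 (by simp only [z]; omega))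
      have hzy : finRotate (m + 1) z = y := by
        ext
        rw [val_finRotate, if_neg] <;> simp only [z] <;> omega
      by_contra hy'
      have := h z hz j hj (hzy ▸ hy') hjr
      have := congrArg Fin.val this
      simp only [z] at this
      omega
  refine ⟨i, j, Fin.pos_iff_ne_zero.2 fun h => h0 (h ▸ hi), hij, ?_⟩
  ext y
  rw [Finset.mem_Icc]
  refine ⟨fun hy => ⟨hge y hy, hle y hy⟩, fun ⟨h1, h2⟩ => ?_⟩
  exact hmem (y - i) y (by have := Fin.le_def.1 h1; omega) h2

theorem mul_signedSum_Icc {m : ℕ} (hπ : cycleCount (finRotate (m + 1)) = 1) (x : R)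
    {i j : Fin (m + 1)} (hi : 0 < i) (hij : i ≤ j) :
    x * signedSum (finRotate (m + 1)) x (Finset.Icc i j) =
      -(fallingFactorial x (j + 1 - i) * risingFactorial x (m + 1 - (j + 1 - i))) := by
  have h1 := Fin.lt_def.1 hi
  have h2 := Fin.le_def.1 hij
  rw [mul_signedSum_of_unique _ hπ x (a := j) (Finset.mem_Icc.2 ⟨hij, le_rfl⟩), Fin.card_Icc,
    Fintype.card_fin]
  · rw [Finset.mem_Icc, Fin.le_def, Fin.le_def, val_finRotate]
    simp only [Fin.val_zero] at h1
    split_ifs <;> omega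
  · intro y hy hyj
    rw [Finset.mem_Icc, Fin.le_def, Fin.le_def] at hy
    have := Fin.val_ne_of_ne hyj
    have := j.2
    rw [Finset.mem_Icc, Fin.le_def, Fin.le_def, val_finRotate]
    split_ifs <;> omega

theorem mul_sum_finRotate {m : ℕ} (hπ : cycleCount (finRotate (m + 1)) = 1) (x : R) :
    x * ∑ ζ : Perm (Fin (m + 1)) with cycleCount ζ = 1, x ^ cycleCount (ζ * finRotate (m + 1)) =
      x * risingFactorial x (m + 1) - ∑ k ∈ Finset.range m,
        ((m : R) - k) * (fallingFactorial x (k + 1) * risingFactorial x (m + 1 - (k + 1))) := by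
  rw [sum_single_cycles_eq_sum_signedSum _ 0]
  set Q : Finset (Fin (m + 1) × Fin (m + 1)) :=
    Finset.univ.filter fun q => 0 < q.1 ∧ q.1 ≤ q.2 with hQ
  have hQmem : ∀ q, q ∈ Q ↔ 0 < q.1 ∧ q.1 ≤ q.2 := fun q => by simp [hQ]
  have hinj : Set.InjOn (fun q : Fin (m + 1) × Fin (m + 1) => Finset.Icc q.1 q.2) Q := by
    intro q hq q' hq' h
    have hq := ((hQmem q).1 hq).2
    have hq' := ((hQmem q').1 hq').2
    have a1 := (Finset.Icc_subset_Icc_iff hq).1 (h.subset)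
    have a2 := (Finset.Icc_subset_Icc_iff hq').1 (h.symm.subset)
    exact Prod.ext (le_antisymm a2.1 a1.1) (le_antisymm a1.2 a2.2)
  have hempty : ∅ ∉ Q.image fun q => Finset.Icc q.1 q.2 := by
    simp only [Finset.mem_image, Finset.Icc_eq_empty_iff, not_exists, not_and, not_not]
    exact fun q hq => ((hQmem q).1 hq).2
  have hsub : insert ∅ (Q.image fun q => Finset.Icc q.1 q.2) ⊆
      (Finset.univ.erase (0 : Fin (m + 1))).powerset := by
    intro S hS
    rw [Finset.mem_powerset, Finset.subset_erase]
    refine ⟨Finset.subset_univ _, ?_⟩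
    rcases Finset.mem_insert.1 hS with rfl | hS
    · simp
    · obtain ⟨q, hq, rfl⟩ := Finset.mem_image.1 hS
      simp only [Finset.mem_Icc, not_and_or, not_le]
      exact Or.inl ((hQmem q).1 hq).1
  rw [← Finset.sum_subset hsub, Finset.sum_insert hempty, Finset.sum_image hinj, signedSum_empty,
    Fintype.card_fin, mul_add, Finset.mul_sum,
    ← sum_pairs (fun k => fallingFactorial x k * risingFactorial x (m + 1 - k)),
    sub_eq_add_neg, ← Finset.sum_neg_distrib]
  · congr 1
    refine Finset.sum_congr rfl fun q hq => ?_
    exact mul_signedSum_Icc hπ x ((hQmem q).1 hq).1 ((hQmem q).1 hq).2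
  · intro S hS hS'
    rw [Finset.mem_powerset, Finset.subset_erase] at hS
    by_contra hne
    refine hS' (Finset.mem_insert.2 ?_)
    by_cases hSe : S = ∅
    · exact Or.inl hSe
    · right
      obtain ⟨i, j, hi, hij, rfl⟩ := exists_eq_Icc hS.2 (Finset.nonempty_iff_ne_empty.2 hSe)
        fun a ha b hb ha' hb' => by
          by_contra hab
          exact hne (signedSum_eq_zero _ x hab ha hb ha' hb')
      exact Finset.mem_image.2 ⟨(i, j), (hQmem _).2 ⟨hi, hij⟩, rfl⟩

theorem isConj_finRotate {m : ℕ} {π : Perm (Fin (m + 1))} (hπ : cycleCount π = 1) :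
    IsConj (finRotate (m + 1)) π := by
  rcases m with _ | m
  · have : Subsingleton (Perm (Fin (0 + 1))) := inferInstanceAs (Subsingleton (Perm (Fin 1)))
    rw [Subsingleton.elim π (finRotate (0 + 1))]
  · rw [Perm.isConj_iff_cycleType_eq, cycleType_finRotate]
    have h1 := cycleType_sum_add_card_fixed π
    have h2 := hπ
    rw [cycleCount] at h2
    rw [Fintype.card_fin] at h1
    have h3 : π.cycleType.card ≠ 0 := by
      intro h
      rw [Multiset.card_eq_zero.1 h] at h1 h2
      simp only [Multiset.sum_zero, Multiset.card_zero] at h1 h2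
      omega
    obtain ⟨a, ha⟩ := Multiset.card_eq_one.1 (show π.cycleType.card = 1 by omega)
    rw [ha, Multiset.sum_singleton] at h1
    rw [ha, Multiset.card_singleton] at h2
    rw [ha, show a = m + 2 by omega]

theorem mul_sum_single_cycles {m : ℕ} {π : Perm (Fin (m + 1))} (hπ : cycleCount π = 1) (x : R) :
    ((m + 1 : ℕ) : R) * ((m + 1 : ℕ) + 1) *
      (x * ∑ ζ : Perm (Fin (m + 1)) with cycleCount ζ = 1, x ^ cycleCount (ζ * π)) =
      x * (risingFactorial x (m + 1 + 1) - fallingFactorial x (m + 1 + 1)) := by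
  obtain ⟨τ, hτ⟩ := isConj_iff.1 (isConj_finRotate hπ)
  have hρ : cycleCount (finRotate (m + 1)) = 1 := by
    rwa [← hτ, cycleCount_conj] at hπ
  have hsum : ∑ ζ : Perm (Fin (m + 1)) with cycleCount ζ = 1, x ^ cycleCount (ζ * π) =
      ∑ ζ : Perm (Fin (m + 1)) with cycleCount ζ = 1,
        x ^ cycleCount (ζ * finRotate (m + 1)) := by
    rw [Finset.sum_filter, Finset.sum_filter, ← Equiv.sum_comp (MulAut.conj τ).toEquiv]
    refine Finset.sum_congr rfl fun ζ _ => ?_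
    simp only [MulEquiv.toEquiv_eq_coe, MulEquiv.coe_toEquiv, MulAut.conj_apply, cycleCount_conj]
    rw [← hτ, show τ * ζ * τ⁻¹ * (τ * finRotate (m + 1) * τ⁻¹) =
      τ * (ζ * finRotate (m + 1)) * τ⁻¹ by group, cycleCount_conj]
  have hT := sum_fallingFactorial_mul_risingFactorial x (m + 1)
  rw [Finset.sum_range_succ'] at hT
  have hT' : ∀ k, ((m + 1 : ℕ) : R) - (k + 1 : ℕ) = m - k := fun k => by push_cast; ring
  simp only [hT'] at hT
  rw [hsum, mul_sum_finRotate hρ, risingFactorial_succ x (m + 1)]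
  rw [risingFactorial_succ x (m + 1)] at hT
  have h0 : fallingFactorial x 0 = 1 := by simp [fallingFactorial]
  simp only [h0, Nat.sub_zero] at hT
  push_cast at hT ⊢
  linear_combination (-1) * hT

end Rotation

theorem coeff_IOPoly {m : ℕ} {π : Perm (Fin (m + 1))} (hπ : cycleCount π = 1) (k : ℕ) :
    ((m + 1 : ℕ) : ℝ) * ((m + 1 : ℕ) + 1) * (IOPoly π).coeff k =
      2 * Nat.stirlingFirst (m + 1 + 1) (2 * k + 1 + m % 2) := by
  have h := mul_sum_single_cycles hπ (X : ℝ[X])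
  rw [mul_left_comm] at h
  have h := mul_left_cancel₀ X_ne_zero h
  have h := congrArg (fun p => p.coeff (2 * k + 1 + m % 2)) h
  simp only [coeff_sub, coeff_risingFactorial_X, coeff_fallingFactorial_X] at h
  have hodd : Odd (m + 1 + 1 + (2 * k + 1 + m % 2)) := by
    rw [Nat.odd_iff]
    omega
  rw [hodd.neg_one_pow] at h
  have hcoeff : (IOPoly π).coeff k = (∑ ζ : Perm (Fin (m + 1)) with cycleCount ζ = 1,
      (X : ℝ[X]) ^ cycleCount (ζ * π)).coeff (2 * k + 1 + m % 2) := by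
    rw [IOPoly, finsetSum_coeff, finsetSum_coeff]
    refine Finset.sum_congr rfl fun ζ hζ => ?_
    have hζ : cycleCount ζ = 1 := by simpa using hζ
    have hs : sign (ζ * π) = 1 := by
      rw [Perm.sign_mul, sign_eq_neg_one_pow_cycleCount, sign_eq_neg_one_pow_cycleCount π, hζ, hπ,
        ← mul_pow]
      simp
    have h1 := card_add_cycleCount_mod_two hs
    have h2 := cycleCount_pos (ζ * π)
    rw [Fintype.card_fin] at h1
    rw [coeff_X_pow, coeff_X_pow, cycleCount_mul_comm]
    congr 1
    apply propext
    omega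
  rw [hcoeff]
  rw [← Nat.cast_add_one, ← Nat.cast_mul, coeff_natCast_mul] at h
  push_cast at h ⊢
  linarith

/-- The IO-polynomial of an `n`-cycle is log-concave. -/
theorem stmt_14 (n : ℕ) (hn : 1 ≤ n) (π : Equiv.Perm (Fin n)) (hπ : cycleCount π = 1) :
    ∀ k : ℕ, 1 ≤ k →
      (IOPoly π).coeff (k - 1) * (IOPoly π).coeff (k + 1) ≤ ((IOPoly π).coeff k) ^ 2 := by
  intro k hk
  obtain ⟨m, rfl⟩ := Nat.exists_eq_add_of_le' hn
  obtain ⟨l, rfl⟩ := Nat.exists_eq_add_of_le' hk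
  have h0 := coeff_IOPoly hπ l
  have h1 := coeff_IOPoly hπ (l + 1)
  have h2 := coeff_IOPoly hπ (l + 1 + 1)
  have hc : (0 : ℝ) < ((m + 1 : ℕ) : ℝ) * ((m + 1 : ℕ) + 1) := by positivity
  have hs := stirlingFirst_mul_le (m + 1 + 1) (i := 2 * l + 1 + m % 2)
    (j := 2 * (l + 1) + 1 + m % 2) 2 (by omega)
  rw [show 2 * (l + 1) + 1 + m % 2 + 2 = 2 * (l + 1 + 1) + 1 + m % 2 by ring,
    show 2 * l + 1 + m % 2 + 2 = 2 * (l + 1) + 1 + m % 2 by ring] at hs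
  have hs : (Nat.stirlingFirst (m + 1 + 1) (2 * l + 1 + m % 2) : ℝ) *
      Nat.stirlingFirst (m + 1 + 1) (2 * (l + 1 + 1) + 1 + m % 2) ≤
      Nat.stirlingFirst (m + 1 + 1) (2 * (l + 1) + 1 + m % 2) *
      Nat.stirlingFirst (m + 1 + 1) (2 * (l + 1) + 1 + m % 2) := by exact_mod_cast hs
  rw [Nat.add_sub_cancel]
  generalize ((m + 1 : ℕ) : ℝ) * ((m + 1 : ℕ) + 1) = c at *
  refine le_of_mul_le_mul_left ?_ (mul_pos hc hc)
  calc c * c * ((IOPoly π).coeff l * (IOPoly π).coeff (l + 1 + 1))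
      = (c * (IOPoly π).coeff l) * (c * (IOPoly π).coeff (l + 1 + 1)) := by ring
    _ ≤ (c * (IOPoly π).coeff (l + 1)) * (c * (IOPoly π).coeff (l + 1)) := by
      rw [h0, h1, h2]
      linarith
    _ = c * c * (IOPoly π).coeff (l + 1) ^ 2 := by ring
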